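/- Let P ⊂ ℝ³ be a set of n ≥ 4 points in convex and general position. Then s_1(P), the number of segments of depth exactly 1, satisfies s_1(P) ≤ 3n − 12. -/

import Mathlib

/-- Points of `ℝ³` as triples. -/
abbrev V3 : Type := ℝ × ℝ × ℝ

/-- The standard dot product on `ℝ³`. -/
def dot3 (a x : V3) : ℝ := a.1 * x.1 + a.2.1 * x.2.1 + a.2.2 * x.2.2

/-- Number of points of `P` strictly on the positive side of the plane `dot3 a • = c`. -/
noncomputable def sideGT (P : Finset V3) (a : V3) (c : ℝ) : ℕ :=
  {x ∈ (P : Set V3) | c < dot3 a x}.ncard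

/-- Number of points of `P` strictly on the negative side of the plane `dot3 a • = c`. -/
noncomputable def sideLT (P : Finset V3) (a : V3) (c : ℝ) : ℕ :=
  {x ∈ (P : Set V3) | dot3 a x < c}.ncard

/-- The segment `pq` has depth at least `k` with respect to `P`: every plane through
`p` and `q` has at least `k` points of `P` strictly on each of its two open sides. -/
def DepthAtLeast (P : Finset V3) (p q : V3) (k : ℕ) : Prop :=
  ∀ a : V3, a ≠ 0 → dot3 a p = dot3 a q →
    k ≤ sideGT P a (dot3 a p) ∧ k ≤ sideLT P a (dot3 a p)

/-- The segment `pq` has depth exactly `k`: `k` is the smallest integer such that every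
plane through `p` and `q` has at least `k` points of `P` strictly on each side. -/
def DepthEq (P : Finset V3) (p q : V3) (k : ℕ) : Prop :=
  DepthAtLeast P p q k ∧ ¬ DepthAtLeast P p q (k + 1)

/-- General position in `ℝ³`: no four points of `P` are coplanar. -/
def GenPos3 (P : Finset V3) : Prop :=
  ∀ s : Finset V3, s ⊆ P → s.card = 4 → ¬ Coplanar ℝ (s : Set V3)

/-- Convex position: every point of `P` is a vertex of the convex hull of `P`. -/
def ConvexPos3 (P : Finset V3) : Prop :=
  ∀ p ∈ P, p ∉ convexHull ℝ ((P.erase p : Finset V3) : Set V3)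

/-- The number of segments of `P` of depth exactly `j`. -/
noncomputable def sj (P : Finset V3) (j : ℕ) : ℕ :=
  {e : Finset V3 | ∃ u ∈ P, ∃ v ∈ P, u ≠ v ∧ e = {u, v} ∧ DepthEq P u v j}.ncard

section UniformSystem

open Finset

variable {ι W : Type*} [AddCommGroup W] [Module ℝ W]

/-- The face, cut out by the vanishing of `ℓ i` for `i ∈ S`, of the polytope of all `x` with
`ℓ i x ≥ 0` for `i ∈ Q` and `∑ i ∈ Q, ℓ i x = 1`. -/
def faceSet (Q : Finset ι) (ℓ : ι → W →ₗ[ℝ] ℝ) (S : Finset ι) : Set W :=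
  {x | (∀ i ∈ Q, 0 ≤ ℓ i x) ∧ ∑ i ∈ Q, ℓ i x = 1 ∧ ∀ i ∈ S, ℓ i x = 0}

/-- The indices in `Q` of the functionals vanishing at `x`. -/
noncomputable def zeroIdx (Q : Finset ι) (ℓ : ι → W →ₗ[ℝ] ℝ) (x : W) : Finset ι :=
  open Classical in {i ∈ Q | ℓ i x = 0}

/-- The nonempty faces cut out by exactly `s` of the functionals. -/
noncomputable def facesOfCard (Q : Finset ι) (ℓ : ι → W →ₗ[ℝ] ℝ) (s : ℕ) :
    Finset (Finset ι) :=
  open Classical in {S ∈ Q.powersetCard s | (faceSet Q ℓ S).Nonempty}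

/-- A family of functionals on an `(r + 1)`-dimensional space, any `r + 1` of which
have no common nontrivial zero. -/
structure IsUniformSystem (Q : Finset ι) (ℓ : ι → W →ₗ[ℝ] ℝ) (r : ℕ) : Prop where
  finrank_eq : Module.finrank ℝ W = r + 1
  lt_card : r < #Q
  eq_zero : ∀ x, r < #(zeroIdx Q ℓ x) → x = 0

variable {Q : Finset ι} {ℓ : ι → W →ₗ[ℝ] ℝ} {r : ℕ}

theorem mem_zeroIdx {x : W} {i : ι} : i ∈ zeroIdx Q ℓ x ↔ i ∈ Q ∧ ℓ i x = 0 := by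
  simp [zeroIdx]

theorem mem_facesOfCard {s : ℕ} {S : Finset ι} :
    S ∈ facesOfCard Q ℓ s ↔ (S ⊆ Q ∧ #S = s) ∧ (faceSet Q ℓ S).Nonempty := by
  simp [facesOfCard, mem_powersetCard]

theorem faceSet_anti {S T : Finset ι} (h : S ⊆ T) : faceSet Q ℓ T ⊆ faceSet Q ℓ S :=
  fun _ hx => ⟨hx.1, hx.2.1, fun i hi => hx.2.2 i (h hi)⟩

namespace IsUniformSystem

theorem ne_zero_of_mem {S : Finset ι} {x : W} (hx : x ∈ faceSet Q ℓ S) : x ≠ 0 := by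
  rintro rfl
  have := hx.2.1
  simp at this

theorem finiteDimensional (h : IsUniformSystem Q ℓ r) : FiniteDimensional ℝ W :=
  Module.finite_of_finrank_pos (by rw [h.finrank_eq]; omega)

theorem card_zeroIdx_le (h : IsUniformSystem Q ℓ r) {S : Finset ι} {x : W}
    (hx : x ∈ faceSet Q ℓ S) : #(zeroIdx Q ℓ x) ≤ r := by
  by_contra! hlt
  exact ne_zero_of_mem hx (h.eq_zero x hlt)

theorem zeroIdx_eq (h : IsUniformSystem Q ℓ r) {T : Finset ι} (hTQ : T ⊆ Q) (hT : #T = r) {x : W}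
    (hx : x ∈ faceSet Q ℓ T) : zeroIdx Q ℓ x = T := by
  refine (eq_of_subset_of_card_le (fun i hi => mem_zeroIdx.2 ⟨hTQ hi, hx.2.2 i hi⟩) ?_).symm
  rw [hT]
  exact h.card_zeroIdx_le hx

/-- Moving inside a face along a feasible direction until a new functional vanishes. -/
theorem exists_step (h : IsUniformSystem Q ℓ r) {S : Finset ι} {x v : W}
    (hx : x ∈ faceSet Q ℓ S) (hv : v ≠ 0) (hsum : ∑ i ∈ Q, ℓ i v = 0)
    (hfeas : ∀ i ∈ Q, ℓ i x = 0 → 0 ≤ ℓ i v) (hS : ∀ i ∈ S, ℓ i v = 0) :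
    ∃ t : ℝ, 0 < t ∧ x + t • v ∈ faceSet Q ℓ S ∧
      ∃ k ∈ Q, 0 < ℓ k x ∧ ℓ k (x + t • v) = 0 := by
  classical
  have hneg : {i ∈ Q | ℓ i v < 0}.Nonempty := by
    by_contra hne
    rw [not_nonempty_iff_eq_empty, filter_eq_empty_iff] at hne
    have hz := (sum_eq_zero_iff_of_nonneg (fun i hi => not_lt.1 (hne hi))).1 hsum
    refine hv (h.eq_zero v (h.lt_card.trans_le (card_le_card fun i hi => ?_)))
    exact mem_zeroIdx.2 ⟨hi, hz i hi⟩
  obtain ⟨k, hk, hmin⟩ := exists_min_image _ (fun i => ℓ i x / (-ℓ i v)) hneg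
  obtain ⟨hkQ, hkv⟩ := mem_filter.1 hk
  have hkx : 0 < ℓ k x := by
    refine lt_of_le_of_ne (hx.1 k hkQ) fun h0 => ?_
    linarith [hfeas k hkQ h0.symm]
  have ht : 0 < ℓ k x / (-ℓ k v) := div_pos hkx (by linarith)
  refine ⟨ℓ k x / (-ℓ k v), ht, ⟨fun i hi => ?_, ?_, fun i hi => ?_⟩, k, hkQ, hkx, ?_⟩
  · simp only [map_add, map_smul, smul_eq_mul]
    rcases lt_or_ge (ℓ i v) 0 with hiv | hiv
    · have h1 := hmin i (mem_filter.2 ⟨hi, hiv⟩)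
      have h2 := (le_div_iff₀ (by linarith : 0 < -ℓ i v)).1 h1
      linarith
    · have := hx.1 i hi
      positivity
  · simp only [map_add, map_smul, smul_eq_mul, sum_add_distrib, ← mul_sum, hsum, hx.2.1]
    ring
  · simp [hx.2.2 i hi, hS i hi]
  · simp only [map_add, map_smul, smul_eq_mul]
    have : ℓ k v ≠ 0 := hkv.ne
    field_simp
    ring

/-- Below every point of a face there is a vertex of that face. -/
theorem exists_vertex_le (h : IsUniformSystem Q ℓ r) {S : Finset ι} (hSQ : S ⊆ Q)
    (φ : W →ₗ[ℝ] ℝ) {x : W} (hx : x ∈ faceSet Q ℓ S) :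
    ∃ y, φ y ≤ φ x ∧ ∃ T ∈ facesOfCard Q ℓ r, S ⊆ T ∧ y ∈ faceSet Q ℓ T := by
  classical
  induction hm : r - #(zeroIdx Q ℓ x) using Nat.strong_induction_on generalizing x with
  | _ m ih =>
    have hSx : S ⊆ zeroIdx Q ℓ x := fun i hi => mem_zeroIdx.2 ⟨hSQ hi, hx.2.2 i hi⟩
    rcases (h.card_zeroIdx_le hx).lt_or_eq with hlt | heq
    · have := h.finiteDimensional
      let L : W →ₗ[ℝ] (zeroIdx Q ℓ x → ℝ) × ℝ :=
        (LinearMap.pi fun i => ℓ i.1).prod (∑ i ∈ Q, ℓ i)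
      have hker : L.ker ≠ ⊥ := by
        apply LinearMap.ker_ne_bot_of_finrank_lt
        rw [h.finrank_eq]
        simpa using hlt
      obtain ⟨v₀, hv₀, hne₀⟩ := (Submodule.ne_bot_iff _).1 hker
      obtain ⟨v, hv, hne, hφ⟩ : ∃ v ∈ L.ker, v ≠ 0 ∧ φ v ≤ 0 := by
        rcases le_total (φ v₀) 0 with h0 | h0
        · exact ⟨v₀, hv₀, hne₀, h0⟩
        · exact ⟨-v₀, neg_mem hv₀, neg_ne_zero.2 hne₀, by simpa using h0⟩
      have hL : L v = 0 := hv
      have hz : ∀ i ∈ zeroIdx Q ℓ x, ℓ i v = 0 := fun i hi =>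
        congrFun (congrArg Prod.fst hL) ⟨i, hi⟩
      have hs : ∑ i ∈ Q, ℓ i v = 0 := by
        have := congrArg Prod.snd hL
        simpa [L] using this
      obtain ⟨t, ht, hmem, k, hk, hkx, hky⟩ := h.exists_step hx hne hs
        (fun i hi h0 => (hz i (mem_zeroIdx.2 ⟨hi, h0⟩)).ge) (fun i hi => hz i (hSx hi))
      have hlt' : #(zeroIdx Q ℓ x) < #(zeroIdx Q ℓ (x + t • v)) := by
        refine card_lt_card ((ssubset_iff_of_subset fun i hi => ?_).2 ⟨k, ?_, ?_⟩)
        · have := (mem_zeroIdx.1 hi).2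
          exact mem_zeroIdx.2 ⟨(mem_zeroIdx.1 hi).1, by simp [this, hz i hi]⟩
        · exact mem_zeroIdx.2 ⟨hk, hky⟩
        · exact fun hk' => hkx.ne' (mem_zeroIdx.1 hk').2
      obtain ⟨y, hy, hT⟩ := ih _ (by omega) hmem rfl
      refine ⟨y, hy.trans ?_, hT⟩
      simp only [map_add, map_smul, smul_eq_mul]
      nlinarith
    · have hx' : x ∈ faceSet Q ℓ (zeroIdx Q ℓ x) :=
        ⟨hx.1, hx.2.1, fun i hi => (mem_zeroIdx.1 hi).2⟩
      exact ⟨x, le_rfl, _, mem_facesOfCard.2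
        ⟨⟨fun i hi => (mem_zeroIdx.1 hi).1, heq⟩, ⟨x, hx'⟩⟩, hSx, hx'⟩

theorem eq_zero_of_vertex (h : IsUniformSystem Q ℓ r) {T : Finset ι}
    (hT : T ∈ facesOfCard Q ℓ r) {v : W} (hv : ∀ i ∈ T, ℓ i v = 0) (hsum : ∑ i ∈ Q, ℓ i v = 0) :
    v = 0 := by
  classical
  obtain ⟨⟨hTQ, hTr⟩, x, hx⟩ := mem_facesOfCard.1 hT
  obtain ⟨j, hjQ, hjT⟩ := exists_mem_notMem_of_card_lt_card (hTr ▸ h.lt_card : #T < #Q)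
  have hjx : ℓ j x ≠ 0 := fun h0 =>
    hjT (h.zeroIdx_eq hTQ hTr hx ▸ mem_zeroIdx.2 ⟨hjQ, h0⟩)
  have hw : v - (ℓ j v / ℓ j x) • x = 0 := by
    refine h.eq_zero _ ?_
    have hsub : insert j T ⊆ zeroIdx Q ℓ (v - (ℓ j v / ℓ j x) • x) := by
      intro i hi
      rcases mem_insert.1 hi with rfl | hi
      · exact mem_zeroIdx.2 ⟨hjQ, by simp [hjx]⟩
      · exact mem_zeroIdx.2 ⟨hTQ hi, by simp [hv i hi, hx.2.2 i hi]⟩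
    have := card_le_card hsub
    rw [card_insert_of_notMem hjT] at this
    omega
  have hvx := sub_eq_zero.1 hw
  have hc : ℓ j v / ℓ j x = 0 := by
    have := hsum
    rw [hvx] at this
    simpa only [map_smul, smul_eq_mul, ← mul_sum, hx.2.1, mul_one] using this
  rw [hvx, hc, zero_smul]

/-- The edge directions at a vertex. -/
theorem exists_direction (h : IsUniformSystem Q ℓ r) {T : Finset ι}
    (hT : T ∈ facesOfCard Q ℓ r) (k : ι) :
    ∃ v, ∑ i ∈ Q, ℓ i v = 0 ∧ ∀ i ∈ T, (i = k → ℓ i v = 1) ∧ (i ≠ k → ℓ i v = 0) := by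
  classical
  have := h.finiteDimensional
  let L : W →ₗ[ℝ] (T → ℝ) × ℝ := (LinearMap.pi fun i => ℓ i.1).prod (∑ i ∈ Q, ℓ i)
  have hinj : Function.Injective L := by
    rw [injective_iff_map_eq_zero]
    intro v hv
    refine h.eq_zero_of_vertex hT (fun i hi => congrFun (congrArg Prod.fst hv) ⟨i, hi⟩) ?_
    have := congrArg Prod.snd hv
    simpa [L] using this
  have hsurj : Function.Surjective L := by
    refine (LinearMap.injective_iff_surjective_of_finrank_eq_finrank ?_).1 hinj
    rw [h.finrank_eq]
    simp [(mem_facesOfCard.1 hT).1.2]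
  obtain ⟨v, hv⟩ := hsurj (fun i => if i.1 = k then 1 else 0, 0)
  have hi : ∀ i ∈ T, ℓ i v = if i = k then 1 else 0 := fun i hi =>
    congrFun (congrArg Prod.fst hv) ⟨i, hi⟩
  refine ⟨v, ?_, fun i hiT => ⟨fun hk => by rw [hi i hiT, if_pos hk],
    fun hk => by rw [hi i hiT, if_neg hk]⟩⟩
  have := congrArg Prod.snd hv
  simpa [L] using this

/-- Every nonempty face has a unique vertex minimising a generic functional `φ`, and at that vertex
`φ` increases along all edges in the face. -/
theorem card_facesOfCard (h : IsUniformSystem Q ℓ r) {v : Finset ι → ι → W}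
    (hv : ∀ T ∈ facesOfCard Q ℓ r, ∀ k, ∑ i ∈ Q, ℓ i (v T k) = 0 ∧
      ∀ i ∈ T, (i = k → ℓ i (v T k) = 1) ∧ (i ≠ k → ℓ i (v T k) = 0))
    {φ : W →ₗ[ℝ] ℝ} (hφ : ∀ T ∈ facesOfCard Q ℓ r, ∀ k ∈ T, φ (v T k) ≠ 0)
    {s m : ℕ} (hsm : s + m = r) :
    #(facesOfCard Q ℓ s) =
      ∑ T ∈ facesOfCard Q ℓ r, (#{k ∈ T | 0 < φ (v T k)}).choose m := by
  classical
  have hex : ∀ T, ∃ x, T ∈ facesOfCard Q ℓ r → x ∈ faceSet Q ℓ T := fun T => by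
    by_cases hT : T ∈ facesOfCard Q ℓ r
    · obtain ⟨x, hx⟩ := (mem_facesOfCard.1 hT).2
      exact ⟨x, fun _ => hx⟩
    · exact ⟨0, fun h => (hT h).elim⟩
  choose x hx using hex
  have hdec : ∀ T ∈ facesOfCard Q ℓ r, ∀ S, ∀ y ∈ faceSet Q ℓ S,
      y = x T + ∑ k ∈ T, ℓ k y • v T k := by
    intro T hT S y hy
    refine sub_eq_zero.1 (h.eq_zero_of_vertex hT (fun i hi => ?_) ?_)
    · simp only [map_sub, map_add, map_sum, map_smul, smul_eq_mul, (hx T hT).2.2 i hi]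
      rw [sum_eq_single_of_mem i hi fun k _ hki => ?_]
      · simp [((hv T hT i).2 i hi).1 rfl]
      · simp [((hv T hT k).2 i hi).2 hki.symm]
    · simp only [map_sub, map_add, map_sum, map_smul, smul_eq_mul, sum_sub_distrib,
        sum_add_distrib, hy.2.1, (hx T hT).2.1]
      rw [sum_comm]
      simp [← mul_sum, (hv T hT _).1]
  have hle : ∀ T ∈ facesOfCard Q ℓ r, ∀ R ⊆ ({k ∈ T | 0 < φ (v T k)} : Finset ι),
      ∀ y ∈ faceSet Q ℓ (T \ R), φ (x T) ≤ φ y ∧ (φ (x T) = φ y → ∀ k ∈ T, ℓ k y = 0) := by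
    intro T hT R hR y hy
    have hnn : ∀ k ∈ T, 0 ≤ ℓ k y * φ (v T k) := fun k hk => by
      by_cases hkR : k ∈ R
      · exact mul_nonneg (hy.1 k ((mem_facesOfCard.1 hT).1.1 hk)) (mem_filter.1 (hR hkR)).2.le
      · simp [hy.2.2 k (mem_sdiff.2 ⟨hk, hkR⟩)]
    have heq : φ y = φ (x T) + ∑ k ∈ T, ℓ k y * φ (v T k) := by
      conv_lhs => rw [hdec T hT _ y hy]
      simp
    refine ⟨by linarith [sum_nonneg hnn], fun he k hk => ?_⟩
    have h0 := (sum_eq_zero_iff_of_nonneg hnn).1 (by linarith) k hk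
    exact (mul_eq_zero.1 h0).resolve_right (hφ T hT k hk)
  simp_rw [← card_powersetCard]
  rw [← card_sigma]
  symm
  refine card_bij (fun p _ => p.1 \ p.2) ?_ ?_ ?_
  · rintro ⟨T, R⟩ hp
    obtain ⟨hT, hR⟩ := mem_sigma.1 hp
    obtain ⟨hRT, hRm⟩ := mem_powersetCard.1 hR
    have hRT' : R ⊆ T := hRT.trans (filter_subset _ _)
    obtain ⟨⟨hTQ, hTr⟩, -⟩ := mem_facesOfCard.1 hT
    refine mem_facesOfCard.2 ⟨⟨sdiff_subset.trans hTQ, ?_⟩,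
      x T, faceSet_anti sdiff_subset (hx T hT)⟩
    rw [card_sdiff_of_subset hRT']
    dsimp only at *
    omega
  · rintro ⟨T, R⟩ hp ⟨T', R'⟩ hp' he
    obtain ⟨hT, hR⟩ := mem_sigma.1 hp
    obtain ⟨hT', hR'⟩ := mem_sigma.1 hp'
    dsimp only at *
    have hRT := (mem_powersetCard.1 hR).1
    have hRT' := (mem_powersetCard.1 hR').1
    have h1 := hle T hT R hRT (x T') (he ▸ faceSet_anti sdiff_subset (hx T' hT'))
    have h2 := hle T' hT' R' hRT' (x T) (he ▸ faceSet_anti sdiff_subset (hx T hT))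
    have hz := h1.2 (le_antisymm h1.1 h2.1)
    obtain ⟨⟨hTQ, hTr⟩, -⟩ := mem_facesOfCard.1 hT
    obtain ⟨⟨hTQ', hTr'⟩, -⟩ := mem_facesOfCard.1 hT'
    have hsub : T ⊆ T' := fun k hk => by
      rw [← h.zeroIdx_eq hTQ' hTr' (hx T' hT')]
      exact mem_zeroIdx.2 ⟨hTQ hk, hz k hk⟩
    obtain rfl := eq_of_subset_of_card_le hsub (by omega)
    have hRR : R = R' := by
      rw [← Finset.sdiff_sdiff_eq_self (hRT.trans (filter_subset _ _)), he,
        Finset.sdiff_sdiff_eq_self (hRT'.trans (filter_subset _ _))]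
    rw [hRR]
  · intro S hS
    obtain ⟨⟨hSQ, hSs⟩, y, hy⟩ := mem_facesOfCard.1 hS
    obtain ⟨-, -, T₀, hT₀, hST₀, -⟩ := h.exists_vertex_le hSQ φ hy
    obtain ⟨T, hT, hmin⟩ := exists_min_image {T ∈ facesOfCard Q ℓ r | S ⊆ T} (fun T => φ (x T))
      ⟨T₀, mem_filter.2 ⟨hT₀, hST₀⟩⟩
    obtain ⟨hT, hST⟩ := mem_filter.1 hT
    obtain ⟨⟨hTQ, hTr⟩, -⟩ := mem_facesOfCard.1 hT
    refine ⟨⟨T, T \ S⟩, mem_sigma.2 ⟨hT, mem_powersetCard.2 ⟨fun k hk => ?_, ?_⟩⟩,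
      Finset.sdiff_sdiff_eq_self hST⟩
    · obtain ⟨hkT, hkS⟩ := mem_sdiff.1 hk
      refine mem_filter.2 ⟨hkT, (hφ T hT k hkT).lt_or_gt.resolve_left fun hneg => ?_⟩
      have hfeas : ∀ i ∈ Q, ℓ i (x T) = 0 → 0 ≤ ℓ i (v T k) := fun i hi h0 => by
        have hiT : i ∈ T := h.zeroIdx_eq hTQ hTr (hx T hT) ▸ mem_zeroIdx.2 ⟨hi, h0⟩
        by_cases hik : i = k
        · rw [((hv T hT k).2 i hiT).1 hik]
          exact zero_le_one
        · exact (((hv T hT k).2 i hiT).2 hik).ge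
      obtain ⟨t, ht, hmem, -⟩ := h.exists_step (faceSet_anti hST (hx T hT)) (v := v T k)
        (fun h0 => hφ T hT k hkT (by simp [h0])) (hv T hT k).1 hfeas
        (fun i hi => ((hv T hT k).2 i (hST hi)).2 (by rintro rfl; exact hkS hi))
      obtain ⟨z, hz, T', hT', hST', hzT'⟩ := h.exists_vertex_le hSQ φ hmem
      have hzx : z = x T' := by
        have := hdec T' hT' _ z hzT'
        rwa [sum_eq_zero fun i hi => by rw [hzT'.2.2 i hi, zero_smul], add_zero] at this
      have := hmin T' (mem_filter.2 ⟨hT', hST'⟩)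
      rw [← hzx] at this
      simp only [map_add, map_smul, smul_eq_mul] at hz
      nlinarith
    · rw [card_sdiff_of_subset hST]
      omega

/-- Euler's formula for simple three-dimensional polytopes, as a count of edges. -/
theorem card_edges (h : IsUniformSystem Q ℓ 3)
    (hfacet : ∀ i ∈ Q, (faceSet Q ℓ {i}).Nonempty) :
    #(facesOfCard Q ℓ 2) + 6 = 3 * #Q := by
  classical
  have hex : ∀ T k, ∃ v, T ∈ facesOfCard Q ℓ 3 → ∑ i ∈ Q, ℓ i v = 0 ∧
      ∀ i ∈ T, (i = k → ℓ i v = 1) ∧ (i ≠ k → ℓ i v = 0) := fun T k => by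
    by_cases hT : T ∈ facesOfCard Q ℓ 3
    · obtain ⟨v, hv⟩ := h.exists_direction hT k
      exact ⟨v, fun _ => hv⟩
    · exact ⟨0, fun h => (hT h).elim⟩
  choose v hv' using hex
  have hv : ∀ T ∈ facesOfCard Q ℓ 3, ∀ k, ∑ i ∈ Q, ℓ i (v T k) = 0 ∧
      ∀ i ∈ T, (i = k → ℓ i (v T k) = 1) ∧ (i ≠ k → ℓ i (v T k) = 0) :=
    fun T hT k => hv' T k hT
  obtain ⟨φ, hφ⟩ : ∃ φ : W →ₗ[ℝ] ℝ, ∀ T ∈ facesOfCard Q ℓ 3, ∀ k ∈ T, φ (v T k) ≠ 0 := by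
    have := h.finiteDimensional
    have hne : ∀ p : (Σ T : facesOfCard Q ℓ 3, T.1), v p.1.1 p.2.1 ≠ 0 := by
      rintro ⟨⟨T, hT⟩, ⟨k, hk⟩⟩ h0
      have := ((hv T hT k).2 k hk).1 rfl
      simp only at h0
      simp [h0] at this
    obtain ⟨φ, hφ⟩ := Module.exists_dual_forall_apply_ne_zero (K := ℝ) _ hne
    exact ⟨φ, fun T hT k hk => hφ ⟨⟨T, hT⟩, ⟨k, hk⟩⟩⟩
  have hφ' : ∀ T ∈ facesOfCard Q ℓ 3, ∀ k ∈ T, (-φ) (v T k) ≠ 0 := fun T hT k hk => by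
    simpa using hφ T hT k hk
  have hcard : ∀ T ∈ facesOfCard Q ℓ 3,
      #{k ∈ T | 0 < φ (v T k)} + #{k ∈ T | 0 < (-φ) (v T k)} = 3 := fun T hT => by
    rw [← (mem_facesOfCard.1 hT).1.2, ← card_filter_add_card_filter_not
      (s := T) (fun k => 0 < φ (v T k))]
    congr 2
    refine filter_congr fun k hk => ?_
    have := hφ T hT k hk
    rw [LinearMap.neg_apply, neg_pos, not_lt]
    exact ⟨le_of_lt, fun hle => lt_of_le_of_ne hle this⟩
  have hone : facesOfCard Q ℓ 1 = Q.powersetCard 1 := by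
    ext S
    rw [mem_facesOfCard, mem_powersetCard, and_iff_left_iff_imp]
    rintro ⟨hSQ, hS⟩
    obtain ⟨i, rfl⟩ := card_eq_one.1 hS
    exact hfacet i (singleton_subset_iff.1 hSQ)
  have hzero : facesOfCard Q ℓ 0 = {∅} := by
    ext S
    rw [mem_facesOfCard, mem_singleton, card_eq_zero]
    refine ⟨fun hS => hS.1.2, ?_⟩
    rintro rfl
    obtain ⟨i, hi⟩ : Q.Nonempty := card_pos.1 (by have := h.lt_card; omega)
    exact ⟨⟨empty_subset _, rfl⟩, (hfacet i hi).mono (faceSet_anti (empty_subset _))⟩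
  have e2 := h.card_facesOfCard hv hφ (s := 2) (m := 1) rfl
  have e1 := h.card_facesOfCard hv hφ (s := 1) (m := 2) rfl
  have e0 := h.card_facesOfCard hv hφ (s := 0) (m := 3) rfl
  have e1' := h.card_facesOfCard hv hφ' (s := 1) (m := 2) rfl
  have e0' := h.card_facesOfCard hv hφ' (s := 0) (m := 3) rfl
  rw [hone, card_powersetCard, Nat.choose_one_right] at e1 e1'
  rw [hzero, card_singleton] at e0 e0'
  have key : ∀ a b : ℕ, a + b = 3 →
      a.choose 1 + 3 * a.choose 3 + 3 * b.choose 3 = 2 * a.choose 2 + b.choose 2 := by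
    intro a b hab
    obtain rfl : b = 3 - a := by omega
    have : a ≤ 3 := by omega
    interval_cases a <;> rfl
  have hsum := sum_congr (rfl : facesOfCard Q ℓ 3 = _) fun T hT => key _ _ (hcard T hT)
  simp only [sum_add_distrib, ← mul_sum] at hsum
  omega

end IsUniformSystem

end UniformSystem

section HullEdges

open Finset

/-- Evaluation at `p` of the affine function `dot3 a • - c` encoded by `(a, c)`. -/
def planeFun (p : V3) : V3 × ℝ →ₗ[ℝ] ℝ where
  toFun x := dot3 x.1 p - x.2
  map_add' x y := by
    simp only [dot3, Prod.fst_add, Prod.snd_add]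
    ring
  map_smul' t x := by
    simp only [dot3, Prod.smul_fst, Prod.smul_snd, smul_eq_mul, RingHom.id_apply]
    ring

theorem planeFun_apply (p : V3) (x : V3 × ℝ) : planeFun p x = dot3 x.1 p - x.2 := rfl

theorem dot3_neg (a x : V3) : dot3 (-a) x = -dot3 a x := by
  simp only [dot3, Prod.fst_neg, Prod.snd_neg]
  ring

theorem dot3_zero (x : V3) : dot3 0 x = 0 := by
  simp [dot3]

theorem coplanar_of_dot3_eq {a : V3} (ha : a ≠ 0) {c : ℝ} {s : Set V3}
    (hs : ∀ x ∈ s, dot3 a x = c) : Coplanar ℝ s := by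
  let L : V3 →ₗ[ℝ] ℝ :=
    { toFun := dot3 a
      map_add' := fun x y => by
        simp only [dot3, Prod.fst_add, Prod.snd_add]
        ring
      map_smul' := fun t x => by
        simp only [dot3, Prod.smul_fst, Prod.smul_snd, smul_eq_mul, RingHom.id_apply]
        ring }
  have hL : L ≠ 0 := by
    intro h0
    have h1 : dot3 a a = 0 := LinearMap.congr_fun h0 a
    simp only [dot3] at h1
    apply ha
    ext <;> simp only [Prod.fst_zero, Prod.snd_zero] <;> nlinarith
  have hle : vectorSpan ℝ s ≤ L.ker := by
    rw [vectorSpan_def, Submodule.span_le]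
    rintro _ ⟨x, hx, y, hy, rfl⟩
    have : L x - L y = 0 := sub_eq_zero.2 ((hs x hx).trans (hs y hy).symm)
    simpa using this
  have hker : Module.finrank ℝ L.ker ≤ 2 := by
    have h1 := L.finrank_range_add_finrank_ker
    have h2 : Module.finrank ℝ L.range ≠ 0 := fun h => by
      rw [Submodule.finrank_eq_zero, LinearMap.range_eq_bot] at h
      exact hL h
    have h3 : Module.finrank ℝ V3 = 3 := by simp
    omega
  rw [coplanar_iff_finrank_le_two]
  exact (Submodule.finrank_mono hle).trans hker

theorem GenPos3.mono {P Q : Finset V3} (hP : GenPos3 P) (h : Q ⊆ P) : GenPos3 Q :=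
  fun s hs => hP s (hs.trans h)

theorem ConvexPos3.mono {P Q : Finset V3} (hP : ConvexPos3 P) (h : Q ⊆ P) : ConvexPos3 Q :=
  fun p hp hmem => hP p (h hp) (convexHull_mono (coe_subset.2 (erase_subset_erase p h)) hmem)

theorem GenPos3.isUniformSystem {P : Finset V3} (hP : GenPos3 P) (h4 : 4 ≤ #P) :
    IsUniformSystem P planeFun 3 where
  finrank_eq := by simp
  lt_card := h4
  eq_zero := by
    rintro ⟨a, c⟩ hx
    obtain ⟨s, hs, hs4⟩ := exists_subset_card_eq (Nat.succ_le_of_lt hx)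
    have hplane : ∀ p ∈ s, dot3 a p = c := fun p hp =>
      sub_eq_zero.1 (mem_zeroIdx.1 (hs hp)).2
    have ha : a = 0 := by
      by_contra ha
      exact hP s (fun p hp => (mem_zeroIdx.1 (hs hp)).1) hs4 (coplanar_of_dot3_eq ha hplane)
    obtain ⟨p, hp⟩ : s.Nonempty := card_pos.1 (by omega)
    have hc := hplane p hp
    rw [ha, dot3_zero] at hc
    rw [ha, ← hc]
    rfl

theorem faceSet_nonempty_of_nonneg {P S : Finset V3} (h : IsUniformSystem P planeFun 3)
    {x : V3 × ℝ} (hx : x ≠ 0) (hnn : ∀ p ∈ P, 0 ≤ planeFun p x) (hS : ∀ p ∈ S, planeFun p x = 0) :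
    (faceSet P planeFun S).Nonempty := by
  have hpos : 0 < ∑ p ∈ P, planeFun p x := by
    refine lt_of_le_of_ne (sum_nonneg hnn) fun h0 => hx (h.eq_zero x ?_)
    have hz := (sum_eq_zero_iff_of_nonneg hnn).1 h0.symm
    exact h.lt_card.trans_le (card_le_card fun p hp => mem_zeroIdx.2 ⟨hp, hz p hp⟩)
  refine ⟨(∑ p ∈ P, planeFun p x)⁻¹ • x, fun p hp => ?_, ?_, fun p hp => ?_⟩
  · rw [map_smul]
    exact mul_nonneg (inv_nonneg.2 hpos.le) (hnn p hp)
  · simp only [map_smul, smul_eq_mul, ← mul_sum]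
    exact inv_mul_cancel₀ hpos.ne'
  · rw [map_smul, hS p hp, smul_zero]

theorem ConvexPos3.faceSet_singleton_nonempty {P : Finset V3} (hP : ConvexPos3 P)
    (h : IsUniformSystem P planeFun 3) {p : V3} (hp : p ∈ P) :
    (faceSet P planeFun {p}).Nonempty := by
  obtain ⟨f, u, hfp, hfu⟩ := geometric_hahn_banach_point_closed (convex_convexHull ℝ _)
    ((P.erase p).finite_toSet.isClosed_convexHull ℝ) (hP p hp)
  have hf : ∀ x : V3, dot3 (f (1, 0, 0), f (0, 1, 0), f (0, 0, 1)) x = f x := fun x => by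
    have hx : x = x.1 • ((1, 0, 0) : V3) + x.2.1 • ((0, 1, 0) : V3) + x.2.2 • ((0, 0, 1) : V3) := by
      ext <;> simp
    conv_rhs => rw [hx]
    simp only [dot3, map_add, map_smul, smul_eq_mul]
    ring
  have hlt : ∀ q ∈ P.erase p, f p < f q := fun q hq =>
    hfp.trans (hfu q (subset_convexHull ℝ _ hq))
  refine faceSet_nonempty_of_nonneg h
    (x := ((f (1, 0, 0), f (0, 1, 0), f (0, 0, 1)), f p)) (fun h0 => ?_) (fun q hq => ?_) ?_
  · obtain ⟨q, hq⟩ : (P.erase p).Nonempty := by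
      have := h.lt_card
      rw [← card_pos, card_erase_of_mem hp]
      omega
    have h1 := planeFun_apply q ((f (1, 0, 0), f (0, 1, 0), f (0, 0, 1)), f p)
    rw [hf, h0, map_zero, Prod.snd_zero, sub_zero] at h1
    have h2 : f p = 0 := congrArg Prod.snd h0
    linarith [hlt q hq]
  · rw [planeFun_apply, hf]
    by_cases hqp : q = p
    · rw [hqp, sub_self]
    · linarith [hlt q (mem_erase.2 ⟨hqp, hq⟩)]
  · intro q hq
    rw [mem_singleton.1 hq, planeFun_apply, hf, sub_self]

/-- The pairs of points of `Q` contained in a supporting plane of `Q`. -/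
noncomputable def hullEdges (Q : Finset V3) : Finset (Finset V3) :=
  open Classical in {S ∈ Q.powersetCard 2 |
    ∃ a : V3, a ≠ 0 ∧ ∃ c : ℝ, (∀ p ∈ Q, c ≤ dot3 a p) ∧ ∀ p ∈ S, dot3 a p = c}

theorem mem_hullEdges {Q S : Finset V3} : S ∈ hullEdges Q ↔ (S ⊆ Q ∧ #S = 2) ∧
    ∃ a : V3, a ≠ 0 ∧ ∃ c : ℝ, (∀ p ∈ Q, c ≤ dot3 a p) ∧ ∀ p ∈ S, dot3 a p = c := by
  simp [hullEdges, mem_powersetCard]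

/-- A supporting plane of `P` remains one after deleting a point outside the edge. -/
theorem hullEdges_mono {P Q S : Finset V3} (hQ : Q ⊆ P) (hS : S ∈ hullEdges P) (hSQ : S ⊆ Q) :
    S ∈ hullEdges Q := by
  obtain ⟨⟨-, h2⟩, a, ha, c, hc, hSc⟩ := mem_hullEdges.1 hS
  exact mem_hullEdges.2 ⟨⟨hSQ, h2⟩, a, ha, c, fun p hp => hc p (hQ hp), hSc⟩

theorem card_hullEdges {Q : Finset V3} (hgen : GenPos3 Q) (hconv : ConvexPos3 Q) (h4 : 4 ≤ #Q) :
    #(hullEdges Q) + 6 = 3 * #Q := by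
  have h := hgen.isUniformSystem h4
  rw [← h.card_edges fun p hp => hconv.faceSet_singleton_nonempty h hp]
  congr 2
  ext S
  rw [mem_hullEdges, mem_facesOfCard]
  refine and_congr_right fun ⟨hSQ, hS2⟩ => ⟨?_, ?_⟩
  · rintro ⟨a, ha, c, hc, hSc⟩
    exact faceSet_nonempty_of_nonneg h (x := (a, c)) (fun h0 => ha (congrArg Prod.fst h0))
      (fun p hp => sub_nonneg.2 (hc p hp)) (fun p hp => sub_eq_zero.2 (hSc p hp))
  · rintro ⟨⟨a, c⟩, hx⟩
    refine ⟨a, ?_, c, fun p hp => sub_nonneg.1 (hx.1 p hp), fun p hp => sub_eq_zero.1 (hx.2.2 p hp)⟩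
    rintro rfl
    obtain ⟨p, hp⟩ : S.Nonempty := card_pos.1 (by omega)
    have hc := hx.2.2 p hp
    rw [planeFun_apply, dot3_zero, zero_sub, neg_eq_zero] at hc
    dsimp only at hc
    subst hc
    exact IsUniformSystem.ne_zero_of_mem hx rfl

theorem card_hullEdges_le {Q : Finset V3} (hgen : GenPos3 Q) (hconv : ConvexPos3 Q)
    (h3 : 3 ≤ #Q) : #(hullEdges Q) + 6 ≤ 3 * #Q := by
  rcases h3.eq_or_lt with h | h
  · have : #(hullEdges Q) ≤ #(Q.powersetCard 2) :=
      card_le_card fun S hS => mem_powersetCard.2 (mem_hullEdges.1 hS).1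
    rw [card_powersetCard, ← h, show Nat.choose 3 2 = 3 from rfl] at this
    omega
  · exact (card_hullEdges hgen hconv h).le

theorem sideLT_neg (P : Finset V3) (a : V3) (c : ℝ) : sideLT P (-a) (-c) = sideGT P a c := by
  simp only [sideLT, sideGT, dot3_neg, neg_lt_neg_iff]

/-- A plane with few points on some side may be oriented so that these lie on its negative side. -/
theorem not_depthAtLeast_iff {P : Finset V3} {u v : V3} {k : ℕ} :
    ¬ DepthAtLeast P u v k ↔
      ∃ a : V3, a ≠ 0 ∧ dot3 a u = dot3 a v ∧ sideLT P a (dot3 a u) < k := by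
  constructor
  · intro h
    simp only [DepthAtLeast, not_forall, not_and_or, not_le] at h
    obtain ⟨a, ha, huv, h | h⟩ := h
    · refine ⟨-a, neg_ne_zero.2 ha, by rw [dot3_neg, dot3_neg, huv], ?_⟩
      rwa [dot3_neg, sideLT_neg]
    · exact ⟨a, ha, huv, h⟩
  · rintro ⟨a, ha, huv, h⟩ hd
    exact (hd a ha huv).2.not_gt h

/-- A segment of depth one is an edge of `conv (P \ {p})` for some `p ∈ P`, but not of `conv P`. -/
theorem exists_mem_hullEdges_erase {P : Finset V3} {u v : V3} (hu : u ∈ P) (hv : v ∈ P)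
    (huv : u ≠ v) (hd : DepthEq P u v 1) :
    ∃ p ∈ P, ({u, v} : Finset V3) ∈ hullEdges (P.erase p) \ hullEdges P := by
  obtain ⟨a, ha, he, hlt⟩ := not_depthAtLeast_iff.1 hd.2
  have h1 : {x ∈ (P : Set V3) | dot3 a x < dot3 a u}.ncard = 1 :=
    le_antisymm (Nat.le_of_lt_succ hlt) (hd.1 a ha he).2
  obtain ⟨p, hp⟩ := Set.ncard_eq_one.1 h1
  have hpmem : p ∈ P ∧ dot3 a p < dot3 a u := by
    have : p ∈ {x ∈ (P : Set V3) | dot3 a x < dot3 a u} := hp ▸ rfl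
    exact this
  have hup : u ≠ p := by
    rintro rfl
    exact hpmem.2.false
  have hvp : v ≠ p := by
    rintro rfl
    exact (he ▸ hpmem.2).false
  refine ⟨p, hpmem.1, mem_sdiff.2 ⟨mem_hullEdges.2
    ⟨⟨?_, card_pair huv⟩, a, ha, dot3 a u, fun q hq => ?_, ?_⟩, fun hP => ?_⟩⟩
  · simp [insert_subset_iff, hup, hvp, hu, hv]
  · obtain ⟨hqp, hqP⟩ := mem_erase.1 hq
    by_contra! hlt'
    have : q ∈ ({p} : Set V3) := hp ▸ ⟨hqP, hlt'⟩
    exact hqp this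
  · simp [he]
  · obtain ⟨-, b, hb, c, hc, hS⟩ := mem_hullEdges.1 hP
    have hbu := hS u (by simp)
    have hbv := hS v (by simp)
    have hge := (hd.1 b hb (hbu.trans hbv.symm)).2
    have h0 : sideLT P b (dot3 b u) = 0 := by
      rw [sideLT, Set.ncard_eq_zero ((P.finite_toSet).subset (Set.sep_subset _ _)),
        Set.eq_empty_iff_forall_notMem]
      rintro x ⟨hxP, hx⟩
      rw [hbu] at hx
      exact (hc x hxP).not_gt hx
    omega

/-- Double counting of the pairs of an edge of `conv P` and a point of `P` off that edge. -/
theorem sum_card_hullEdges_avoiding (P : Finset V3) :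
    ∑ p ∈ P, #{S ∈ hullEdges P | p ∉ S} = #(hullEdges P) * (#P - 2) := by
  have h := sum_card_bipartiteAbove_eq_sum_card_bipartiteBelow
    (s := P) (t := hullEdges P) (fun p S => p ∉ S)
  simp only [bipartiteAbove, bipartiteBelow] at h
  rw [h]
  refine sum_const_nat fun S hS => ?_
  obtain ⟨⟨hSP, hS2⟩, -⟩ := mem_hullEdges.1 hS
  rw [filter_notMem_eq_sdiff, card_sdiff_of_subset hSP, hS2]

theorem card_hullEdges_erase_sdiff {P : Finset V3} (hgen : GenPos3 P) (hconv : ConvexPos3 P)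
    (h4 : 4 ≤ #P) {p : V3} (hp : p ∈ P) :
    #(hullEdges (P.erase p) \ hullEdges P) + #{S ∈ hullEdges P | p ∉ S} + 9 ≤ 3 * #P := by
  have hsub : {S ∈ hullEdges P | p ∉ S} ⊆ hullEdges (P.erase p) ∩ hullEdges P := by
    intro S hS
    obtain ⟨hS, hpS⟩ := mem_filter.1 hS
    refine mem_inter.2 ⟨hullEdges_mono (erase_subset _ _) hS ?_, hS⟩
    exact subset_erase.2 ⟨(mem_hullEdges.1 hS).1.1, hpS⟩
  have h1 := card_le_card hsub
  have h2 := card_sdiff_add_card_inter (hullEdges (P.erase p)) (hullEdges P)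
  have hc : #(P.erase p) = #P - 1 := card_erase_of_mem hp
  have h3 := card_hullEdges_le (hgen.mono (erase_subset p P)) (hconv.mono (erase_subset p P))
    (by omega)
  omega

end HullEdges

/-- A convex-position set of `n ≥ 4` points has at most `3n − 12` segments of depth one. -/
theorem stmt15 (P : Finset V3) (n : ℕ) (hn : P.card = n) (hn4 : 4 ≤ n)
    (hgen : GenPos3 P) (hconv : ConvexPos3 P) :
    (sj P 1 : ℤ) ≤ 3 * n - 12 := by
  subst hn
  have hsj : sj P 1 ≤ ∑ p ∈ P, (hullEdges (P.erase p) \ hullEdges P).card := by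
    refine le_trans ?_ Finset.card_biUnion_le
    rw [sj, ← Set.ncard_coe_finset]
    refine Set.ncard_le_ncard ?_ (Finset.finite_toSet _)
    rintro _ ⟨u, hu, v, hv, huv, rfl, hd⟩
    obtain ⟨p, hp, hmem⟩ := exists_mem_hullEdges_erase hu hv huv hd
    exact Finset.mem_coe.2 (Finset.mem_biUnion.2 ⟨p, hp, hmem⟩)
  have hsum := Finset.sum_le_sum fun p hp => card_hullEdges_erase_sdiff hgen hconv hn4 hp
  rw [Finset.sum_add_distrib, Finset.sum_add_distrib, sum_card_hullEdges_avoiding,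
    Finset.sum_const, Finset.sum_const, smul_eq_mul, smul_eq_mul] at hsum
  have hE := card_hullEdges hgen hconv hn4
  obtain ⟨m, hm⟩ := Nat.exists_eq_add_of_le hn4
  rw [hm] at hsum hE ⊢
  have hE' : (hullEdges P).card = 3 * m + 6 := by omega
  rw [hE', show 4 + m - 2 = m + 2 by omega] at hsum
  zify at hsum hsj
  push_cast
  nlinarith
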